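/- For every n ≥ 1 and every x ∈ ℝ: n/γ_n = (β_n − x) R_{n,n−1}(x) + γ_n R_{n−1,n−1}(x) + γ_{n+1} R_{n+1,n−1}(x). -/

import Mathlib

open MeasureTheory Polynomial Real

section OrthogonalPolynomials

variable {L : ℝ[X] →ₗ[ℝ] ℝ} {p : ℕ → ℝ[X]}

/-- The `n`-th orthogonal polynomial annihilates all polynomials of degree less than `n`. -/
theorem functional_mul_eq_zero_of_degree_lt
    (hmonic : ∀ n, (p n).Monic) (hdeg : ∀ n, (p n).natDegree = n)
    (horth : ∀ n m, n ≠ m → L (p n * p m) = 0) (n m : ℕ) (hm : m ≤ n)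
    (q : ℝ[X]) (hq : q.degree < m) : L (p n * q) = 0 := by
  induction m generalizing q with
  | zero =>
    have : q = 0 := by simpa using hq
    simp [this]
  | succ m ih =>
    have hr : (q - C (q.coeff m) * p m).degree < m := by
      rw [degree_lt_iff_coeff_zero] at hq ⊢
      intro k hk
      rcases hk.eq_or_lt with rfl | hk
      · have : (p m).coeff m = 1 := by simpa [Monic, leadingCoeff, hdeg] using hmonic m
        simp [this]
      · simp [hq k hk, coeff_eq_zero_of_natDegree_lt (p := p m) (by rwa [hdeg])]
    have h1 := ih (by omega) _ hr
    have h2 : p n * (q - C (q.coeff m) * p m) = p n * q - q.coeff m • (p n * p m) := by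
      rw [smul_eq_C_mul]; ring
    rwa [h2, map_sub, map_smul, horth n m (by omega), smul_zero, sub_zero] at h1

/-- Pairing the `n`-th orthogonal polynomial with a polynomial of degree at most `n` extracts
its coefficient of degree `n`. -/
theorem functional_mul_eq_coeff_mul
    (hmonic : ∀ n, (p n).Monic) (hdeg : ∀ n, (p n).natDegree = n)
    (horth : ∀ n m, n ≠ m → L (p n * p m) = 0) (n : ℕ)
    (q : ℝ[X]) (hq : q.natDegree ≤ n) : L (p n * q) = q.coeff n * L (p n * p n) := by
  have hr : (q - C (q.coeff n) * p n).degree < n := by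
    rw [degree_lt_iff_coeff_zero]
    intro k hk
    rcases hk.eq_or_lt with rfl | hk
    · have : (p n).coeff n = 1 := by simpa [Monic, leadingCoeff, hdeg] using hmonic n
      simp [this]
    · simp [coeff_eq_zero_of_natDegree_lt (hq.trans_lt hk),
        coeff_eq_zero_of_natDegree_lt (p := p n) (by rwa [hdeg])]
  have h1 := functional_mul_eq_zero_of_degree_lt hmonic hdeg horth n n le_rfl _ hr
  have h2 : p n * (q - C (q.coeff n) * p n) = p n * q - q.coeff n • (p n * p n) := by
    rw [smul_eq_C_mul]; ring
  rw [h2, map_sub, map_smul, smul_eq_mul] at h1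
  linarith

/-- The three-term recurrence for monic orthogonal polynomials. -/
theorem X_mul_eq_three_term
    (hmonic : ∀ n, (p n).Monic) (hdeg : ∀ n, (p n).natDegree = n)
    (horth : ∀ n m, n ≠ m → L (p n * p m) = 0) (hpos : ∀ n, 0 < L (p n * p n))
    (n : ℕ) (b c : ℝ) (hb : L (X * (p (n + 1) * p (n + 1))) = b * L (p (n + 1) * p (n + 1)))
    (hc : L (p (n + 1) * p (n + 1)) = c * L (p n * p n)) :
    X * p (n + 1) = p (n + 2) + b • p (n + 1) + c • p n := by
  have hlead : ∀ k, (p k).coeff k = 1 := fun k => by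
    simpa [Monic, leadingCoeff, hdeg] using hmonic k
  have hvanish : ∀ k l, k < l → (p k).coeff l = 0 := fun k l hkl =>
    coeff_eq_zero_of_natDegree_lt (by rwa [hdeg])
  rw [← sub_eq_zero]
  set r := X * p (n + 1) - (p (n + 2) + b • p (n + 1) + c • p n) with hr
  have hrdeg : ∀ k, n + 2 ≤ k → r.coeff k = 0 := by
    intro k hk
    obtain ⟨k, rfl⟩ : ∃ j, k = j + 1 := ⟨k - 1, by omega⟩
    simp only [hr, coeff_sub, coeff_X_mul, coeff_add, coeff_smul, smul_eq_mul,
      hvanish n (k + 1) (by omega), hvanish (n + 1) (k + 1) (by omega)]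
    rcases (show n + 1 ≤ k by omega).eq_or_lt with rfl | hk'
    · simp [hlead]
    · simp [hvanish (n + 1) k hk', hvanish (n + 2) (k + 1) (by omega)]
  have hpair : ∀ k, k ≤ n + 1 → L (p k * r) = 0 := by
    intro k hk
    have hexp : p k * r = p (n + 1) * (X * p k)
        - (p k * p (n + 2) + b • (p k * p (n + 1)) + c • (p k * p n)) := by
      simp only [hr, smul_eq_C_mul]; ring
    rw [hexp]
    simp only [map_sub, map_add, map_smul, smul_eq_mul, horth k (n + 2) (by omega)]
    rcases hk.eq_or_lt with rfl | hk
    · rw [horth (n + 1) n (by omega), mul_left_comm, hb]; ring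
    · rw [horth k (n + 1) hk.ne, functional_mul_eq_coeff_mul hmonic hdeg horth (n + 1) (X * p k)
        ((natDegree_mul_le).trans (by rw [hdeg, natDegree_X]; omega)), coeff_X_mul]
      rcases (show k ≤ n by omega).eq_or_lt with rfl | hk
      · rw [hlead, hc]; ring
      · rw [hvanish k n hk, horth k n hk.ne]; ring
  by_contra hne
  have hle : r.natDegree ≤ n + 1 := by
    by_contra hlt
    exact hne (leadingCoeff_eq_zero.mp (hrdeg _ (by omega)))
  have h1 := functional_mul_eq_coeff_mul hmonic hdeg horth r.natDegree r le_rfl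
  rw [hpair _ hle] at h1
  exact mul_ne_zero (leadingCoeff_ne_zero.mpr hne) (hpos r.natDegree).ne' h1.symm

end OrthogonalPolynomials

/-- Integration against `exp (-V)`, as a linear functional on polynomials. -/
noncomputable def expWeightFunctional (V : ℝ[X])
    (hint : ∀ q : ℝ[X], Integrable (fun x : ℝ => q.eval x * Real.exp (-(V.eval x)))) :
    ℝ[X] →ₗ[ℝ] ℝ where
  toFun q := ∫ x : ℝ, q.eval x * Real.exp (-(V.eval x))
  map_add' q r := by
    simp only [eval_add, add_mul]
    exact integral_add (hint q) (hint r)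
  map_smul' c q := by
    simp only [eval_smul, smul_eq_mul, mul_assoc, RingHom.id_apply]
    exact integral_const_mul _ _

theorem expWeightFunctional_apply (V : ℝ[X])
    (hint : ∀ q : ℝ[X], Integrable (fun x : ℝ => q.eval x * Real.exp (-(V.eval x)))) (q : ℝ[X]) :
    expWeightFunctional V hint q = ∫ x : ℝ, q.eval x * Real.exp (-(V.eval x)) := rfl

/-- Integration by parts against `exp (-V)`. -/
theorem expWeightFunctional_derivative (V : ℝ[X])
    (hint : ∀ q : ℝ[X], Integrable (fun x : ℝ => q.eval x * Real.exp (-(V.eval x)))) (q : ℝ[X]) :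
    expWeightFunctional V hint (derivative q) = expWeightFunctional V hint (derivative V * q) := by
  rw [← sub_eq_zero, ← map_sub, expWeightFunctional_apply]
  refine integral_eq_zero_of_hasDerivAt_of_integrable (fun x => ?_) (hint _) (hint q)
  refine ((q.hasDerivAt x).mul (V.hasDerivAt x).fun_neg.exp).congr_deriv ?_
  rw [eval_sub, eval_mul]
  ring

theorem stmt9
    (V : Polynomial ℝ)
    (hVeven : Even V.natDegree) (hVdeg : 2 ≤ V.natDegree)
    (hVlead : 0 < V.leadingCoeff)
    (hint : ∀ q : Polynomial ℝ,
      Integrable (fun x : ℝ => q.eval x * Real.exp (-(V.eval x))))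
    (p : ℕ → Polynomial ℝ)
    (hmonic : ∀ n, (p n).Monic)
    (hpdeg : ∀ n, (p n).natDegree = n)
    (horth : ∀ n m, n ≠ m →
      ∫ x : ℝ, (p n).eval x * (p m).eval x * Real.exp (-(V.eval x)) = 0)
    (h : ℕ → ℝ)
    (hh : ∀ n, h n = ∫ x : ℝ, ((p n).eval x) ^ 2 * Real.exp (-(V.eval x)))
    (hhpos : ∀ n, 0 < h n)
    (ψ : ℕ → ℝ → ℝ)
    (hψ : ∀ n x, ψ n x = (p n).eval x * Real.exp (-(V.eval x) / 2) / Real.sqrt (h n))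
    (γ : ℕ → ℝ)
    (hγ : ∀ n, 1 ≤ n → γ n = Real.sqrt (h n / h (n - 1)))
    (β : ℕ → ℝ)
    (hβ : ∀ n, β n = ∫ x : ℝ, x * (ψ n x) ^ 2)
    (W : ℝ → Polynomial ℝ)
    (hW : ∀ x : ℝ, (X - C x) * W x = derivative V - C ((derivative V).eval x))
    (R : ℕ → ℕ → ℝ → ℝ)
    (hR : ∀ i j (x : ℝ), R i j x = ∫ t : ℝ, (W x).eval t * ψ i t * ψ j t)
    (n : ℕ) (hn : 1 ≤ n) (x : ℝ) :
    (n : ℝ) / γ n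
      = (β n - x) * R n (n - 1) x + γ n * R (n - 1) (n - 1) x
        + γ (n + 1) * R (n + 1) (n - 1) x := by
  set L := expWeightFunctional V hint with hL
  have hhL : ∀ k, L (p k * p k) = h k := fun k => by
    simp only [hL, expWeightFunctional_apply, hh, eval_mul, sq]
  have horthL : ∀ k l, k ≠ l → L (p k * p l) = 0 := fun k l hkl => by
    simpa only [hL, expWeightFunctional_apply, eval_mul] using horth k l hkl
  have hψψ : ∀ (q : ℝ[X]) (i j : ℕ), ∫ t : ℝ, q.eval t * ψ i t * ψ j t
      = L (q * (p i * p j)) / (√(h i) * √(h j)) := by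
    intro q i j
    rw [hL, expWeightFunctional_apply, ← integral_div]
    congr 1 with t
    have hexp : Real.exp (-(V.eval t)) = Real.exp (-(V.eval t) / 2) * Real.exp (-(V.eval t) / 2) := by
      rw [← Real.exp_add, add_halves]
    rw [hψ, hψ, hexp, eval_mul, eval_mul]
    ring
  obtain ⟨m, rfl⟩ : ∃ m, n = m + 1 := ⟨n - 1, by omega⟩
  have hs : ∀ k, 0 < √(h k) := fun k => Real.sqrt_pos.mpr (hhpos k)
  have hss : ∀ k, √(h k) * √(h k) = h k := fun k => Real.mul_self_sqrt (hhpos k).le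
  have hγs : ∀ k, γ (k + 1) = √(h (k + 1)) / √(h k) := fun k => by
    rw [hγ _ (by omega), Nat.add_sub_cancel, Real.sqrt_div (hhpos _).le]
  have hβL : L (X * (p (m + 1) * p (m + 1))) = β (m + 1) * L (p (m + 1) * p (m + 1)) := by
    have h1 := hψψ X (m + 1) (m + 1)
    simp only [eval_X, mul_assoc, ← sq] at h1
    rw [← hβ, Real.sq_sqrt (hhpos _).le] at h1
    rw [hhL, h1, ← sq, div_mul_cancel₀ _ (hhpos _).ne']
  have hrec := X_mul_eq_three_term hmonic hpdeg horthL (fun k => by rw [hhL]; exact hhpos k) m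
    (β (m + 1)) (h (m + 1) / h m) hβL (by rw [hhL, hhL, div_mul_cancel₀ _ (hhpos m).ne'])
  have hparts : L (derivative V * (p (m + 1) * p m)) = (m + 1) * h m := by
    have hcoeff : ∀ k, (p k).coeff k = 1 := fun k => by
      simpa [Monic, leadingCoeff, hpdeg] using hmonic k
    have hd : ∀ k, (derivative (p k)).degree < k := fun k => by
      have := degree_derivative_lt (hmonic k).ne_zero
      rwa [degree_eq_natDegree (hmonic k).ne_zero, hpdeg] at this
    have hd' : (derivative (p (m + 1))).natDegree ≤ m := by
      simp [hpdeg]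
    rw [hL, ← expWeightFunctional_derivative, derivative_mul, map_add, ← hL, mul_comm (derivative _),
      functional_mul_eq_coeff_mul hmonic hpdeg horthL m _ hd', coeff_derivative, hcoeff, hhL,
      functional_mul_eq_zero_of_degree_lt hmonic hpdeg horthL (m + 1) m (by omega) _ (hd m)]
    ring
  have hkey : L (W x * (p (m + 2) * p m)) + (β (m + 1) - x) * L (W x * (p (m + 1) * p m))
      + h (m + 1) / h m * L (W x * (p m * p m)) = (m + 1) * h m := by
    have hpoly : W x * (p (m + 2) * p m) + (β (m + 1) - x) • (W x * (p (m + 1) * p m))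
        + (h (m + 1) / h m) • (W x * (p m * p m))
        = derivative V * (p (m + 1) * p m) - (derivative V).eval x • (p (m + 1) * p m) := by
      simp only [smul_eq_C_mul, C_sub] at hrec ⊢
      linear_combination (p (m + 1) * p m) * hW x - W x * p m * hrec
    have h1 := congrArg L hpoly
    simpa only [map_add, map_sub, map_smul, smul_eq_mul, horthL (m + 1) m (by omega), mul_zero,
      sub_zero, hparts] using h1
  simp only [Nat.add_sub_cancel, hR, hψψ, hγs]
  have hm := hs m
  have hm1 := hs (m + 1)
  have hm2 := hs (m + 2)
  rw [← hss m, ← hss (m + 1)] at hkey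
  push_cast
  field_simp at hkey ⊢
  linear_combination -hkey
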